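/- (Theorem 1, achievability, reduced to packet counts.) Let λ > 0, T > 0, let 0 < ε < 1, and set Δ = ε·√(2λ/T). Let P₀ be the Poisson distribution with mean λT (the number of packets Willie observes when Alice is not transmitting) and P₁ the Poisson distribution with mean (λ + Δ)T (the number of packets Willie observes when Alice inserts packets according to an independent Poisson process of rate Δ). Then for every subset A ⊆ ℕ, P₀(A) + P₁(ℕ \ A) ≥ 1 − ε; that is, every detector based on the packet count has sum of false alarm and missed detection probabilities at least 1 − ε. -/

import Mathlib

/-- The Poisson probability mass function with mean `m`: `P(n) = e^{-m} mⁿ / n!`. -/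
noncomputable def poissonPMF (m : ℝ) (n : ℕ) : ℝ :=
  Real.exp (-m) * m ^ n / n.factorial

/-- The probability assigned by a pmf `P` on ℕ to a set `A ⊆ ℕ`. -/
noncomputable def pmfProb (P : ℕ → ℝ) (A : Set ℕ) : ℝ :=
  ∑' n : ℕ, A.indicator P n

theorem hasSum_poissonPMF (m : ℝ) : HasSum (poissonPMF m) 1 := by
  have h := (NormedSpace.expSeries_div_hasSum_exp (𝔸 := ℝ) m).mul_left (Real.exp (-m))
  rw [← Real.exp_eq_exp_ℝ, ← Real.exp_add, neg_add_cancel, Real.exp_zero] at h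
  refine h.congr_fun fun n => ?_
  simp only [poissonPMF, mul_div_assoc]

theorem poissonPMF_nonneg {m : ℝ} (hm : 0 ≤ m) (n : ℕ) : 0 ≤ poissonPMF m n := by
  unfold poissonPMF
  positivity

/-- The geometric mean of two Poisson mass functions is, up to the Bhattacharyya coefficient, the
Poisson mass function whose mean is the geometric mean. -/
theorem poissonPMF_geom_mean (x y : ℝ) (n : ℕ) :
    (Real.exp (-((y - x) ^ 2 / 2)) * poissonPMF (x * y) n) ^ 2 =
      poissonPMF (x ^ 2) n * poissonPMF (y ^ 2) n := by
  have h : Real.exp (-((y - x) ^ 2 / 2)) ^ 2 * Real.exp (-(x * y)) ^ 2 =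
      Real.exp (-x ^ 2) * Real.exp (-y ^ 2) := by
    simp only [← Real.exp_nat_mul, ← Real.exp_add]
    congr 1
    push_cast
    ring
  unfold poissonPMF
  calc _ = (Real.exp (-((y - x) ^ 2 / 2)) ^ 2 * Real.exp (-(x * y)) ^ 2) *
        ((x * y) ^ n / n.factorial) ^ 2 := by ring
    _ = _ := by rw [h]; ring

/-- A weighted arithmetic-geometric mean bound for `|p - q|` through the geometric mean `s`. -/
theorem abs_sub_le_of_sq_eq_mul {p q s c : ℝ} (hp : 0 ≤ p) (hq : 0 ≤ q) (hs : 0 ≤ s)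
    (h : s ^ 2 = p * q) (hc : 0 < c) :
    |p - q| ≤ (c * (p + q - 2 * s) + (p + q + 2 * s) / c) / 2 := by
  have hx : 0 ≤ p + q - 2 * s := by
    have := abs_le_of_sq_le_sq (a := 2 * s) (b := p + q)
      (by nlinarith [sq_nonneg (p - q)]) (by positivity)
    linarith [le_of_abs_le this]
  refine abs_le_of_sq_le_sq' ?_ (by positivity) |> abs_le.mpr
  have hxy : (p - q) ^ 2 = (c * (p + q - 2 * s)) * ((p + q + 2 * s) / c) := by
    field_simp
    linarith
  rw [hxy]
  nlinarith [sq_nonneg (c * (p + q - 2 * s) - (p + q + 2 * s) / c)]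

/-- A lower bound on the total error probability of any test in terms of the Bhattacharyya
coefficient `B` of the two hypotheses. -/
theorem pmfProb_add_pmfProb_compl_ge {P Q S : ℕ → ℝ} {B c : ℝ} (hP : HasSum P 1)
    (hQ : HasSum Q 1) (hS : HasSum S B) (hP0 : ∀ n, 0 ≤ P n) (hQ0 : ∀ n, 0 ≤ Q n)
    (hS0 : ∀ n, 0 ≤ S n) (h : ∀ n, S n ^ 2 = P n * Q n) (hc : 0 < c) (A : Set ℕ) :
    1 - (c * (1 - B) + (1 + B) / c) / 2 ≤ pmfProb P A + pmfProb Q Aᶜ := by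
  have hsum := (hP.summable.indicator A).hasSum.add (hQ.summable.indicator Aᶜ).hasSum
  have hlow := ((hP.add hQ).div_const 2).sub
    ((((((hP.add hQ).sub (hS.mul_left 2)).mul_left c).add
      (((hP.add hQ).add (hS.mul_left 2)).div_const c)).div_const 2).div_const 2)
  refine le_trans (le_of_eq ?_) (hasSum_le (fun n => ?_) hlow hsum)
  · ring
  · have hb := abs_le.mp (abs_sub_le_of_sq_eq_mul (hP0 n) (hQ0 n) (hS0 n) (h n) hc)
    by_cases hn : n ∈ A
    · simp only [Set.indicator, Set.mem_compl_iff, hn, not_true, if_true, if_false]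
      linarith [hb.1]
    · simp only [Set.indicator, Set.mem_compl_iff, hn, not_false_iff, if_true, if_false]
      linarith [hb.2]

/-- Theorem 1 (achievability), reduced to packet counts: with `Δ = ε √(2λ/T)`,
for every detector with rejection region `A ⊆ ℕ`, the sum of the false alarm
probability under `P₀ =` Poisson(λT) and the missed detection probability under
`P₁ =` Poisson((λ+Δ)T) is at least `1 − ε`. -/
theorem covert_insertion_achievability (lam T ε Δ : ℝ) (hlam : 0 < lam) (hT : 0 < T)
    (hε0 : 0 < ε) (hε1 : ε < 1) (hΔ : Δ = ε * Real.sqrt (2 * lam / T)) (A : Set ℕ) :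
    pmfProb (poissonPMF (lam * T)) A + pmfProb (poissonPMF ((lam + Δ) * T)) Aᶜ ≥ 1 - ε := by
  have ha : 0 < lam * T := mul_pos hlam hT
  have hΔ0 : 0 ≤ Δ := by rw [hΔ]; positivity
  obtain ⟨x, hx, hxa⟩ : ∃ x : ℝ, 0 < x ∧ x ^ 2 = lam * T :=
    ⟨√(lam * T), Real.sqrt_pos.mpr ha, Real.sq_sqrt ha.le⟩
  have hb : 0 ≤ (lam + Δ) * T := by positivity
  obtain ⟨y, hy, hyb⟩ : ∃ y : ℝ, 0 ≤ y ∧ y ^ 2 = (lam + Δ) * T :=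
    ⟨√((lam + Δ) * T), Real.sqrt_nonneg _, Real.sq_sqrt hb⟩
  have hxy : x ≤ y := by
    refine le_of_sq_le_sq ?_ hy
    rw [hxa, hyb]
    nlinarith [mul_nonneg hΔ0 hT.le]
  have hd : (y ^ 2 - x ^ 2) ^ 2 = 2 * ε ^ 2 * x ^ 2 := by
    rw [hxa, hyb, hΔ]
    have hsq := Real.sq_sqrt (show 0 ≤ 2 * lam / T by positivity)
    calc _ = ε ^ 2 * √(2 * lam / T) ^ 2 * T ^ 2 := by ring
      _ = _ := by rw [hsq]; field_simp
  have hgap : (y - x) ^ 2 ≤ ε ^ 2 / 2 := by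
    have h4 : 4 * x ^ 2 ≤ (y + x) ^ 2 := by nlinarith
    have hm := mul_le_mul_of_nonneg_left h4 (sq_nonneg (y - x))
    have hx2 : 0 < x ^ 2 := by positivity
    refine le_of_mul_le_mul_right ?_ hx2
    nlinarith
  have hB := Real.add_one_le_exp (-((y - x) ^ 2 / 2))
  have hB1 : Real.exp (-((y - x) ^ 2 / 2)) ≤ 1 :=
    Real.exp_le_one_iff.mpr (by linarith [sq_nonneg (y - x)])
  have hS := (hasSum_poissonPMF (x * y)).mul_left (Real.exp (-((y - x) ^ 2 / 2)))
  rw [← hxa, ← hyb]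
  have key := pmfProb_add_pmfProb_compl_ge (c := 2 / ε) (hasSum_poissonPMF (x ^ 2))
    (hasSum_poissonPMF (y ^ 2)) hS (poissonPMF_nonneg (sq_nonneg x))
    (poissonPMF_nonneg (sq_nonneg y))
    (fun n => mul_nonneg (Real.exp_pos _).le (poissonPMF_nonneg (by positivity) n))
    (poissonPMF_geom_mean x y) (by positivity) A
  refine le_trans ?_ key
  rw [mul_one]
  set B := Real.exp (-((y - x) ^ 2 / 2))
  have h1 : 2 / ε * (1 - B) ≤ ε / 2 := by
    calc 2 / ε * (1 - B) ≤ 2 / ε * (ε ^ 2 / 4) := by gcongr; linarith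
      _ = ε / 2 := by field_simp; norm_num
  have h2 : (1 + B) / (2 / ε) ≤ ε := by
    rw [div_le_iff₀ (by positivity), mul_div_cancel₀ _ hε0.ne']
    linarith
  linarith
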